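/- Define P₊ : (0, ∞) → ℝ by P₊(A) = 4·∫₀^A du / √((A² − u²)·(1 + A²/2 + u²/2)). Then P₊ is strictly decreasing on (0, ∞), P₊(A) tends to 2π as A → 0⁺, and P₊(A) tends to 0 as A → ∞. -/

import Mathlib

open intervalIntegral Filter

/-- The period function of the single-well Duffing equation as a function of
the amplitude `A`. -/
noncomputable def Pplus (A : ℝ) : ℝ :=
  4 * ∫ u in (0:ℝ)..A, 1 / Real.sqrt ((A ^ 2 - u ^ 2) * (1 + A ^ 2 / 2 + u ^ 2 / 2))

open MeasureTheory Set in
/-- The substitution `u = A sin θ` turns the period integral into a regular one. -/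
theorem Pplus_eq_integral_sin {A : ℝ} (hA : 0 < A) :
    Pplus A = 4 * ∫ θ in (0:ℝ)..Real.pi / 2,
      1 / Real.sqrt (1 + A ^ 2 / 2 + (A * Real.sin θ) ^ 2 / 2) := by
  have hpi : 0 < Real.pi / 2 := Real.pi_div_two_pos
  have himage : (fun θ => A * Real.sin θ) '' Ioo 0 (Real.pi / 2) = Ioo 0 A := by
    ext u
    constructor
    · rintro ⟨θ, ⟨h0, h1⟩, rfl⟩
      have hs : 0 < Real.sin θ := Real.sin_pos_of_pos_of_lt_pi h0 (by linarith)
      have hs1 : Real.sin θ < 1 := by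
        rw [← Real.sin_pi_div_two]
        exact Real.sin_lt_sin_of_lt_of_le_pi_div_two (by linarith) le_rfl h1
      exact ⟨by positivity, by nlinarith⟩
    · rintro ⟨h0, h1⟩
      refine ⟨Real.arcsin (u / A), ⟨Real.arcsin_pos.2 (by positivity),
        Real.arcsin_lt_pi_div_two.2 ((div_lt_one hA).2 h1)⟩, ?_⟩
      have hu : u / A ≤ 1 := ((div_lt_one hA).2 h1).le
      have hu0 : 0 < u / A := by positivity
      simp only
      rw [Real.sin_arcsin (by linarith) hu]
      field_simp
  have hinj : InjOn (fun θ => A * Real.sin θ) (Ioo 0 (Real.pi / 2)) := by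
    intro x hx y hy hxy
    exact Real.injOn_sin ⟨by linarith [hx.1], hx.2.le⟩ ⟨by linarith [hy.1], hy.2.le⟩
      (mul_left_cancel₀ hA.ne' hxy)
  unfold Pplus
  rw [integral_of_le hA.le, integral_of_le hpi.le, integral_Ioc_eq_integral_Ioo,
    integral_Ioc_eq_integral_Ioo, ← himage,
    integral_image_eq_integral_abs_deriv_smul measurableSet_Ioo
      (fun θ _ => ((Real.hasDerivAt_sin θ).const_mul A).hasDerivWithinAt) hinj]
  congr 1
  refine setIntegral_congr_fun measurableSet_Ioo fun θ hθ => ?_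
  have hc : 0 < Real.cos θ := Real.cos_pos_of_mem_Ioo ⟨by linarith [hθ.1], hθ.2⟩
  have hq : 0 < Real.sqrt (1 + A ^ 2 / 2 + (A * Real.sin θ) ^ 2 / 2) :=
    Real.sqrt_pos.2 (by positivity)
  have hsq : A ^ 2 - (A * Real.sin θ) ^ 2 = (A * Real.cos θ) ^ 2 := by
    linear_combination A ^ 2 * (Real.sin_sq_add_cos_sq θ).symm
  simp only [smul_eq_mul]
  rw [hsq, Real.sqrt_mul (sq_nonneg _), Real.sqrt_sq (by positivity),
    abs_of_pos (by positivity)]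
  field_simp

theorem continuous_one_div_sqrt_duffing :
    Continuous fun p : ℝ × ℝ =>
      1 / Real.sqrt (1 + p.1 ^ 2 / 2 + (p.1 * Real.sin p.2) ^ 2 / 2) :=
  continuous_const.div (by fun_prop) fun p => (Real.sqrt_pos.2 (by positivity)).ne'

theorem continuous_one_div_sqrt_duffing_right (A : ℝ) :
    Continuous fun θ : ℝ => 1 / Real.sqrt (1 + A ^ 2 / 2 + (A * Real.sin θ) ^ 2 / 2) :=
  continuous_one_div_sqrt_duffing.comp (Continuous.prodMk_right A)

/-- `P₊` is strictly decreasing on `(0, ∞)`, tends to `2π` as `A → 0⁺`,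
and tends to `0` as `A → ∞`. -/
theorem Pplus_strictAnti_and_limits :
    StrictAntiOn Pplus (Set.Ioi (0:ℝ)) ∧
    Tendsto Pplus (nhdsWithin 0 (Set.Ioi (0:ℝ))) (nhds (2 * Real.pi)) ∧
    Tendsto Pplus atTop (nhds 0) := by
  have hpi : 0 < Real.pi / 2 := Real.pi_div_two_pos
  refine ⟨?_, ?_, ?_⟩
  · intro A (hA : 0 < A) B (hB : 0 < B) hAB
    rw [Pplus_eq_integral_sin hA, Pplus_eq_integral_sin hB]
    have hlt : ∀ θ : ℝ, 1 / Real.sqrt (1 + B ^ 2 / 2 + (B * Real.sin θ) ^ 2 / 2)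
        < 1 / Real.sqrt (1 + A ^ 2 / 2 + (A * Real.sin θ) ^ 2 / 2) := by
      intro θ
      refine one_div_lt_one_div_of_lt (Real.sqrt_pos.2 (by positivity))
        (Real.sqrt_lt_sqrt (by positivity) ?_)
      have h : A ^ 2 < B ^ 2 := by gcongr
      have h' : A ^ 2 * Real.sin θ ^ 2 ≤ B ^ 2 * Real.sin θ ^ 2 := by gcongr
      rw [mul_pow, mul_pow]
      linarith
    have := integral_lt_integral_of_continuousOn_of_le_of_exists_lt hpi
      (continuous_one_div_sqrt_duffing_right B).continuousOn
      (continuous_one_div_sqrt_duffing_right A).continuousOn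
      (fun θ _ => (hlt θ).le) ⟨0, ⟨le_rfl, hpi.le⟩, hlt 0⟩
    linarith
  · have hcont : Continuous fun A : ℝ => 4 * ∫ θ in (0:ℝ)..Real.pi / 2,
        1 / Real.sqrt (1 + A ^ 2 / 2 + (A * Real.sin θ) ^ 2 / 2) :=
      continuous_const.mul
        (continuous_parametric_intervalIntegral_of_continuous' continuous_one_div_sqrt_duffing _ _)
    have h0 := hcont.tendsto 0
    have hval : (4 * ∫ θ in (0:ℝ)..Real.pi / 2,
        1 / Real.sqrt (1 + (0:ℝ) ^ 2 / 2 + (0 * Real.sin θ) ^ 2 / 2)) = 2 * Real.pi := by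
      simp
      ring
    rw [hval] at h0
    refine (h0.mono_left nhdsWithin_le_nhds).congr' ?_
    filter_upwards [self_mem_nhdsWithin] with A hA
    exact (Pplus_eq_integral_sin hA).symm
  · have hlim : Tendsto (fun A : ℝ => 4 * Real.pi / A) atTop (nhds 0) :=
      tendsto_const_nhds.div_atTop tendsto_id
    refine squeeze_zero' ?_ ?_ hlim
    · filter_upwards [eventually_gt_atTop 0] with A hA
      rw [Pplus_eq_integral_sin hA]
      exact mul_nonneg (by norm_num) (integral_nonneg hpi.le fun θ _ => by positivity)
    · filter_upwards [eventually_gt_atTop 0] with A hA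
      rw [Pplus_eq_integral_sin hA]
      have hle : ∀ θ : ℝ, 1 / Real.sqrt (1 + A ^ 2 / 2 + (A * Real.sin θ) ^ 2 / 2) ≤ 2 / A := by
        intro θ
        rw [← one_div_div A 2]
        refine one_div_le_one_div_of_le (by positivity) (Real.le_sqrt_of_sq_le ?_)
        nlinarith [sq_nonneg (A * Real.sin θ), sq_nonneg A]
      have := integral_mono_on hpi.le
        ((continuous_one_div_sqrt_duffing_right A).intervalIntegrable _ _)
        (continuous_const.intervalIntegrable (μ := MeasureTheory.volume) 0 (Real.pi / 2))
        fun θ _ => hle θ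
      rw [integral_const, smul_eq_mul] at this
      calc _ ≤ 4 * ((Real.pi / 2 - 0) * (2 / A)) := by gcongr
        _ = 4 * Real.pi / A := by ring
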